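/- The number of triangulations of the regular (n+3)-gon (i.e., of maximal sets of pairwise noncrossing diagonals in the given encoding) equals the Catalan number c_{n+1} = (1/(n+2))·binom(2n+2, n+1). -/

import Mathlib

open MvPolynomial

/-- Diagonals of the regular `(n+3)`-gon: `Sum.inl k` is the negative diagonal
with label `k+1 ∈ {1,…,n}`; `Sum.inr ⟨(a,b), _⟩` is the positive diagonal
`(a+1, b+1)` with `1 ≤ a+1 ≤ b+1 ≤ n`. -/
abbrev Diag (n : ℕ) := Fin n ⊕ {p : Fin n × Fin n // p.1 ≤ p.2}

/-- The crossing relation on diagonals. -/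
def Crosses {n : ℕ} : Diag n → Diag n → Prop
  | Sum.inl _, Sum.inl _ => False
  | Sum.inl k, Sum.inr p => p.1.1 ≤ k ∧ k ≤ p.1.2
  | Sum.inr p, Sum.inl k => p.1.1 ≤ k ∧ k ≤ p.1.2
  | Sum.inr p, Sum.inr q =>
      (p.1.1 ≤ q.1.1 ∧ q.1.1 ≤ p.1.2 ∧ p.1.2 < q.1.2) ∨
      (q.1.1 ≤ p.1.1 ∧ p.1.1 ≤ q.1.2 ∧ q.1.2 < p.1.2)

/-- A triangulation is a maximal set of pairwise noncrossing diagonals. -/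
def IsTriangulation {n : ℕ} (T : Finset (Diag n)) : Prop :=
  (∀ d ∈ T, ∀ d' ∈ T, ¬ Crosses d d') ∧
  ∀ S : Finset (Diag n), T ⊆ S → (∀ d ∈ S, ∀ d' ∈ S, ¬ Crosses d d') → S = T

/-- The set `T⁺` of positive diagonals of `T`. -/
def posPart {n : ℕ} (T : Finset (Diag n)) : Finset (Diag n) :=
  T.filter fun d => d.isRight

/-- The set `T⁻` of negative diagonals of `T`. -/
def negPart {n : ℕ} (T : Finset (Diag n)) : Finset (Diag n) :=
  T.filter fun d => d.isLeft

/-- The label of a diagonal: `k` for the negative diagonal `k`, and the left end `i` for the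
positive diagonal `(i, j)`. -/
def Diag.label {n : ℕ} : Diag n → Fin n
  | Sum.inl k => k
  | Sum.inr p => p.1.1

/-- The exclusive right end of a diagonal, a negative diagonal being seen as an empty interval. -/
def Diag.endpt {n : ℕ} : Diag n → ℕ
  | Sum.inl k => k
  | Sum.inr p => p.1.2 + 1

namespace Diag

variable {n : ℕ}

lemma label_le_endpt (d : Diag n) : (d.label : ℕ) ≤ d.endpt := by
  rcases d with k | ⟨⟨i, j⟩, h⟩
  · exact le_rfl
  · have : (i : ℕ) ≤ j := h
    simp only [label, endpt]
    omega

lemma endpt_le (d : Diag n) : d.endpt ≤ n := by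
  rcases d with k | ⟨⟨i, j⟩, h⟩
  · exact k.2.le
  · exact j.2

lemma ext_label_endpt {d e : Diag n} (hl : d.label = e.label) (hs : d.endpt = e.endpt) : d = e := by
  rcases d with k | ⟨⟨i, j⟩, h⟩ <;> rcases e with k' | ⟨⟨i', j'⟩, h'⟩ <;>
    simp only [label, endpt, Fin.ext_iff, Sum.inl.injEq, Sum.inr.injEq,
      Subtype.mk.injEq, Prod.mk.injEq, reduceCtorEq] at * <;> grind

lemma exists_label_endpt (i : Fin n) {v : ℕ} (hi : i ≤ v) (hv : v ≤ n) :
    ∃ d : Diag n, d.label = i ∧ d.endpt = v := by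
  rcases hi.eq_or_lt with rfl | h
  · exact ⟨Sum.inl i, rfl, rfl⟩
  · refine ⟨Sum.inr ⟨(i, ⟨v - 1, by omega⟩), ?_⟩, rfl, ?_⟩
    · simp only [Fin.le_def]
      omega
    · simp only [endpt]
      omega

lemma crosses_iff (d e : Diag n) :
    Crosses d e ↔
      ((d.label : ℕ) ≤ e.label ∧ (e.label : ℕ) < d.endpt ∧
        (d.endpt < e.endpt ∨ e.endpt = e.label)) ∨
      ((e.label : ℕ) ≤ d.label ∧ (d.label : ℕ) < e.endpt ∧
        (e.endpt < d.endpt ∨ d.endpt = d.label)) := by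
  rcases d with k | ⟨⟨i, j⟩, h⟩ <;> rcases e with k' | ⟨⟨i', j'⟩, h'⟩ <;>
    simp only [Crosses, label, endpt, Fin.le_def, Fin.lt_def] at * <;> grind

lemma eq_of_label_eq {d e : Diag n} (hl : d.label = e.label) (h : ¬ Crosses d e) : d = e := by
  refine ext_label_endpt hl ?_
  rw [crosses_iff] at h
  have := label_le_endpt d
  have := label_le_endpt e
  rw [hl] at *
  omega

end Diag

/-- A pairwise noncrossing set that misses a label can be enlarged by a diagonal of that label. -/
lemma exists_compatible_of_missing_label {n : ℕ} {T : Finset (Diag n)}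
    (hT : ∀ d ∈ T, ∀ e ∈ T, ¬ Crosses d e) {i : Fin n} (hi : ∀ d ∈ T, d.label ≠ i) :
    ∃ d : Diag n, d.label = i ∧ ∀ e ∈ T, ¬ Crosses d e := by
  have hi' : ∀ d ∈ T, (d.label : ℕ) ≠ i := fun d hd h => hi d hd (Fin.ext h)
  by_cases hne : (T.filter fun d => (d.label : ℕ) ≤ i ∧ (i : ℕ) < d.endpt).Nonempty
  · obtain ⟨m, hm, hmin⟩ := Finset.exists_min_image _ Diag.endpt hne
    simp only [Finset.mem_filter] at hm hmin
    obtain ⟨d, hdi, hds⟩ := Diag.exists_label_endpt i hm.2.2.le m.endpt_le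
    refine ⟨d, hdi, fun e he hc => ?_⟩
    have h1 := hT m hm.1 e he
    have h2 := hi' e he
    have h3 := hmin e
    have h4 := e.label_le_endpt
    rw [Diag.crosses_iff] at hc h1
    rw [hdi, hds] at hc
    simp only [he, true_and] at h3
    omega
  · rw [Finset.not_nonempty_iff_eq_empty, Finset.filter_eq_empty_iff] at hne
    obtain ⟨d, hdi, hds⟩ := Diag.exists_label_endpt i le_rfl i.2.le
    refine ⟨d, hdi, fun e he hc => ?_⟩
    have h1 := hne he
    rw [Diag.crosses_iff, hdi, hds] at hc
    omega

lemma isTriangulation_iff {n : ℕ} {T : Finset (Diag n)} :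
    IsTriangulation T ↔
      (∀ d ∈ T, ∀ e ∈ T, ¬ Crosses d e) ∧ ∀ i : Fin n, ∃ d ∈ T, d.label = i := by
  classical
  refine and_congr_right fun hT => ⟨fun hmax i => ?_, fun hfull S hTS hS => ?_⟩
  · by_contra! hi
    obtain ⟨d, hdi, hd⟩ := exists_compatible_of_missing_label hT hi
    have hsymm : ∀ e ∈ T, ¬ Crosses e d := fun e he hc =>
      hd e he <| by rw [Diag.crosses_iff] at hc ⊢; exact hc.symm
    have hself : ¬ Crosses d d := by
      rw [Diag.crosses_iff]
      omega
    have := hmax (insert d T) (Finset.subset_insert d T) (by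
      intro x hx y hy
      rw [Finset.mem_insert] at hx hy
      rcases hx with rfl | hx <;> rcases hy with rfl | hy
      exacts [hself, hd y hy, hsymm x hx, hT x hx y hy])
    exact hi d (this ▸ Finset.mem_insert_self d T) hdi
  · refine Finset.Subset.antisymm (fun d hd => ?_) hTS
    obtain ⟨e, he, hl⟩ := hfull d.label
    exact Diag.eq_of_label_eq hl (hS e (hTS he) d hd) ▸ he

/-- Right-end functions on the interval `[a, b)`: every `i` is assigned `i ≤ g i ≤ b` such that the
half-open intervals `[i, g i)` are nested or disjoint and contain no `k ≠ i` with `g k = k`. If `p`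
holds, no value `g i = i` is allowed at all. -/
def rightEnds (p : Prop) (a b : ℕ) : Set (ℕ → ℕ) :=
  {g | (∀ i, ¬ (a ≤ i ∧ i < b) → g i = 0) ∧
    ∀ i, a ≤ i → i < b → i ≤ g i ∧ g i ≤ b ∧ (p → i < g i) ∧
      ∀ k, i < k → k < g i → k < g k ∧ g k ≤ g i}

instance finite_rightEnds (p : Prop) (a b : ℕ) : Finite (rightEnds p a b) := by
  have hle : ∀ g ∈ rightEnds p a b, ∀ i, g i ≤ b := fun g hg i => by
    by_cases h : a ≤ i ∧ i < b
    · exact (hg.2 i h.1 h.2).2.1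
    · simp [hg.1 i h]
  refine Finite.of_injective
    (fun g (i : Fin b) => (⟨g.1 i, Nat.lt_succ_of_le (hle g.1 g.2 i)⟩ : Fin (b + 1)))
    fun g h hgh => Subtype.ext <| funext fun i => ?_
  by_cases hi : i < b
  · simpa using congrFun hgh ⟨i, hi⟩
  · rw [g.2.1 i (by omega), h.2.1 i (by omega)]

/-- The function equal to `g` on `[a, b)` and to zero elsewhere. -/
def cutOff (a b : ℕ) (g : ℕ → ℕ) (i : ℕ) : ℕ := if a ≤ i ∧ i < b then g i else 0

/-- The first value `v > a` splits a right-end function into its parts on `[a + 1, v)` and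
`[v, b)`. -/
def rightEndsFiberEquiv (p : Prop) {a v b : ℕ} (hav : a < v) (hvb : v ≤ b) :
    {g : rightEnds p a b // g.1 a = v} ≃ rightEnds True (a + 1) v × rightEnds p v b where
  toFun g :=
    (⟨cutOff (a + 1) v g.1.1, by
      obtain ⟨⟨g, hg0, hg⟩, hga⟩ := g
      refine ⟨fun i hi => if_neg hi, fun i hi hiv => ?_⟩
      have h1 := (hg a le_rfl (by omega)).2.2.2 i (by omega) (by simp only at hga; omega)
      have h2 := hg i (by omega) (by omega)
      simp only at hga
      simp only [cutOff]
      refine ⟨by grind, by grind, by grind, fun k hk hk' => ?_⟩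
      have := h2.2.2.2 k hk (by grind)
      grind⟩,
    ⟨cutOff v b g.1.1, by
      obtain ⟨⟨g, hg0, hg⟩, hga⟩ := g
      refine ⟨fun i hi => if_neg hi, fun i hi hiv => ?_⟩
      have h2 := hg i (by omega) (by omega)
      simp only [cutOff]
      refine ⟨by grind, by grind, by grind, fun k hk hk' => ?_⟩
      have := h2.2.2.2 k hk (by grind)
      grind⟩)
  invFun x := ⟨⟨fun i => if i = a then v else if i < v then x.1.1 i else x.2.1 i, by
    obtain ⟨⟨u, hu0, hu⟩, ⟨w, hw0, hw⟩⟩ := x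
    refine ⟨fun i hi => ?_, fun i hi hib => ?_⟩
    · have := hu0 i
      have := hw0 i
      grind
    · by_cases hia : i = a
      · refine ⟨by grind, by grind, by grind, fun k hk hk' => ?_⟩
        have := hu k (by grind) (by grind)
        grind
      · by_cases hiv : i < v
        · have h := hu i (by omega) hiv
          refine ⟨by grind, by grind, by grind, fun k hk hk' => ?_⟩
          have := h.2.2.2 k hk (by grind)
          grind
        · have h := hw i (by omega) hib
          refine ⟨by grind, by grind, by grind, fun k hk hk' => ?_⟩
          have := h.2.2.2 k hk (by grind)
          grind⟩, by simp⟩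
  left_inv g := by
    obtain ⟨⟨g, hg0, hg⟩, hga⟩ := g
    ext i
    have := hg0 i
    simp only at hga
    simp only [cutOff]
    grind
  right_inv x := by
    obtain ⟨⟨u, hu0, hu⟩, ⟨w, hw0, hw⟩⟩ := x
    ext i
    · have := hu0 i
      simp only [cutOff]
      grind
    · have := hw0 i
      simp only [cutOff]
      grind

/-- If the first value is `a` itself, the remaining values are an arbitrary right-end function. -/
def rightEndsFiberSelfEquiv {a b : ℕ} (hab : a < b) :
    {g : rightEnds False a b // g.1 a = a} ≃ rightEnds False (a + 1) b where
  toFun g := ⟨cutOff (a + 1) b g.1.1, by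
    obtain ⟨⟨g, hg0, hg⟩, hga⟩ := g
    refine ⟨fun i hi => if_neg hi, fun i hi hiv => ?_⟩
    have h2 := hg i (by omega) (by omega)
    simp only [cutOff]
    refine ⟨by grind, by grind, by grind, fun k hk hk' => ?_⟩
    have := h2.2.2.2 k hk (by grind)
    grind⟩
  invFun w := ⟨⟨fun i => if i = a then a else w.1 i, by
    obtain ⟨w, hw0, hw⟩ := w
    refine ⟨fun i hi => ?_, fun i hi hib => ?_⟩
    · have := hw0 i
      grind
    · by_cases hia : i = a
      · grind
      · have h := hw i (by omega) hib
        refine ⟨by grind, by grind, by grind, fun k hk hk' => ?_⟩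
        have := h.2.2.2 k hk (by grind)
        grind⟩, by simp⟩
  left_inv g := by
    obtain ⟨⟨g, hg0, hg⟩, hga⟩ := g
    ext i
    have := hg0 i
    simp only at hga
    simp only [cutOff]
    grind
  right_inv w := by
    obtain ⟨w, hw0, hw⟩ := w
    ext i
    have := hw0 i
    simp only [cutOff]
    grind

lemma card_rightEnds_zero (p : Prop) (a : ℕ) : Nat.card (rightEnds p a a) = 1 := by
  rw [Nat.card_eq_one_iff_unique]
  refine ⟨⟨fun g h => Subtype.ext <| funext fun i => ?_⟩,
    ⟨⟨fun _ => 0, fun _ _ => rfl, fun i _ _ => by omega⟩⟩⟩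
  rw [g.2.1 i (by omega), h.2.1 i (by omega)]

lemma card_rightEnds_succ (p : Prop) (a n : ℕ) :
    Nat.card (rightEnds p a (a + (n + 1))) =
      Nat.card {g : rightEnds p a (a + (n + 1)) // g.1 a = a} +
      ∑ m : Fin (n + 1), Nat.card (rightEnds True (a + 1) (a + 1 + m)) *
        Nat.card (rightEnds p (a + 1 + m) (a + 1 + m + (n - m))) := by
  have hmem : ∀ g : rightEnds p a (a + (n + 1)), a ≤ g.1 a ∧ g.1 a ≤ a + (n + 1) := fun g =>
    have h := g.2.2 a le_rfl (by omega)
    ⟨h.1, h.2.1⟩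
  let f : rightEnds p a (a + (n + 1)) → Fin (n + 2) := fun g =>
    ⟨g.1 a - a, by have := hmem g; omega⟩
  have hf : ∀ (g : rightEnds p a (a + (n + 1))) (m : Fin (n + 2)),
      f g = m ↔ g.1 a = a + m := fun g m => by
    have := hmem g
    simp only [f, Fin.ext_iff]
    omega
  rw [Nat.card_congr (Equiv.sigmaFiberEquiv f).symm, Nat.card_sigma, Fin.sum_univ_succ]
  congr 1
  · exact Nat.card_congr (Equiv.subtypeEquivRight fun g => by simp [hf])
  · refine Finset.sum_congr rfl fun m _ => ?_
    have hm := m.2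
    rw [← Nat.card_prod, show a + 1 + m + (n - m) = a + (n + 1) by omega]
    refine Nat.card_congr (Equiv.trans (Equiv.subtypeEquivRight fun g => ?_)
      (rightEndsFiberEquiv p (v := a + 1 + m) (by omega) (by omega)))
    rw [hf, Fin.val_succ]
    omega

lemma card_rightEnds_true (n : ℕ) : ∀ a, Nat.card (rightEnds True a (a + n)) = catalan n := by
  induction n using Nat.strong_induction_on with
  | _ n ih =>
    intro a
    rcases n with _ | n
    · simpa using card_rightEnds_zero True a
    · have hempty : IsEmpty {g : rightEnds True a (a + (n + 1)) // g.1 a = a} :=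
        ⟨fun g => ((g.1.2.2 a le_rfl (by omega)).2.2.1 trivial).ne' g.2⟩
      rw [card_rightEnds_succ, Nat.card_of_isEmpty, zero_add, catalan_succ]
      refine Finset.sum_congr rfl fun m _ => ?_
      rw [ih m m.2, ih (n - m) (by omega)]

lemma card_rightEnds_false (n : ℕ) :
    ∀ a, Nat.card (rightEnds False a (a + n)) = catalan (n + 1) := by
  induction n using Nat.strong_induction_on with
  | _ n ih =>
    intro a
    rcases n with _ | n
    · simpa using card_rightEnds_zero False a
    · rw [card_rightEnds_succ, Nat.card_congr (rightEndsFiberSelfEquiv (by omega)),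
        show a + (n + 1) = a + 1 + n by omega, ih n (by omega), catalan_succ (n + 1),
        Fin.sum_univ_castSucc (n := n + 1)]
      refine (add_comm _ _).trans (congrArg₂ _ ?_ ?_)
      · refine Finset.sum_congr rfl fun m _ => ?_
        have hm := m.2
        rw [card_rightEnds_true, ih (n - m) (by omega), Fin.val_castSucc,
          show n + 1 - m = n - m + 1 by omega]
      · simp

/-- A triangulation is recorded by the right ends of its diagonals, one for each label. -/
lemma card_isTriangulation (n : ℕ) :
    Nat.card {T : Finset (Diag n) // IsTriangulation T} = Nat.card (rightEnds False 0 n) := by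
  classical
  have hdiag : ∀ (g : rightEnds False 0 n) (i : Fin n),
      ∃ d : Diag n, d.label = i ∧ d.endpt = g.1 i := fun g i =>
    have h := g.2.2 i (Nat.zero_le _) i.2
    Diag.exists_label_endpt i h.1 h.2.1
  choose σ hlabel hendpt using hdiag
  have htri : ∀ g, IsTriangulation (Finset.univ.image (σ g)) := fun g => by
    refine isTriangulation_iff.2 ⟨?_, fun i => ⟨σ g i, by simp, hlabel g i⟩⟩
    simp only [Finset.mem_image, Finset.mem_univ, true_and]
    rintro _ ⟨i, rfl⟩ _ ⟨k, rfl⟩ hc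
    rw [Diag.crosses_iff, hlabel, hlabel, hendpt, hendpt] at hc
    have hi := (g.2.2 i (Nat.zero_le _) i.2).2.2.2 k
    have hk := (g.2.2 k (Nat.zero_le _) k.2).2.2.2 i
    rcases eq_or_ne (i : ℕ) k with h | h
    · rw [h] at hc
      omega
    · omega
  refine (Nat.card_congr (Equiv.ofBijective
    (fun g => (⟨_, htri g⟩ : {T : Finset (Diag n) // IsTriangulation T})) ⟨?_, ?_⟩)).symm
  · intro g h hgh
    have himage : Finset.univ.image (σ g) = Finset.univ.image (σ h) := congrArg Subtype.val hgh
    refine Subtype.ext <| funext fun i => ?_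
    by_cases hi : i < n
    · have hmem : σ g ⟨i, hi⟩ ∈ Finset.univ.image (σ h) := himage ▸ by simp
      obtain ⟨k, -, hk⟩ := Finset.mem_image.1 hmem
      have hki : k = ⟨i, hi⟩ := by rw [← hlabel h k, hk, hlabel]
      have hs := hendpt g ⟨i, hi⟩
      rw [← hk, hendpt, hki] at hs
      exact hs.symm
    · rw [g.2.1 i (by omega), h.2.1 i (by omega)]
  · rintro ⟨T, hT⟩
    obtain ⟨hnc, hfull⟩ := isTriangulation_iff.1 hT
    choose τ hτ hτl using hfull
    let g : ℕ → ℕ := fun i => if h : i < n then (τ ⟨i, h⟩).endpt else 0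
    have hg : ∀ i : Fin n, g i = (τ i).endpt := fun i => by simp [g]
    have hmem : g ∈ rightEnds False 0 n := by
      refine ⟨fun i hi => dif_neg (by omega), fun i _ hi => ?_⟩
      lift i to Fin n using hi
      have h1 := (τ i).label_le_endpt
      have h2 := (τ i).endpt_le
      rw [hτl] at h1
      rw [hg]
      refine ⟨h1, h2, False.elim, fun k hik hk => ?_⟩
      lift k to Fin n using hk.trans_le h2
      have h3 := hnc _ (hτ i) _ (hτ k)
      have h4 := (τ k).label_le_endpt
      rw [Diag.crosses_iff] at h3
      rw [hτl] at h4
      rw [hτl, hτl] at h3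
      rw [hg]
      omega
    refine ⟨⟨g, hmem⟩, Subtype.ext ?_⟩
    refine (htri ⟨g, hmem⟩).2 T ?_ hnc |>.symm
    intro d hd
    obtain ⟨i, -, rfl⟩ := Finset.mem_image.1 hd
    have : σ ⟨g, hmem⟩ i = τ i :=
      Diag.ext_label_endpt (by rw [hlabel, hτl]) ((hendpt _ i).trans (hg i))
    exact this ▸ hτ i

/-- The number of triangulations of the regular `(n+3)`-gon equals the Catalan
number `c_{n+1} = (1/(n+2))·binom(2n+2, n+1)`. -/
theorem stmt_11 (n : ℕ) :
    Nat.card {T : Finset (Diag n) // IsTriangulation T} =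
      (2 * n + 2).choose (n + 1) / (n + 2) := by
  have h := card_rightEnds_false n 0
  rw [zero_add] at h
  rw [card_isTriangulation, h, catalan_eq_centralBinom_div, Nat.centralBinom, mul_add, mul_one]
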